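/- In any LTS, branching apartness and semi-branching apartness coincide: for all states q,p, q #_b p holds if and only if q #_sb p holds. -/

import Mathlib

/-- `TauCl tau` is the reflexive-transitive closure `↠τ` of the silent-step relation. -/
def TauCl {X : Type*} (tau : X → X → Prop) : X → X → Prop := Relation.ReflTransGen tau

/-- `Q` is a branching apartness on the LTS `(tau, step)`. -/
def IsBranchingApartness {X A : Type*} (tau : X → X → Prop) (step : A → X → X → Prop)
    (Q : X → X → Prop) : Prop :=
  (∀ q p, Q p q → Q q p) ∧
  (∀ q q' p, tau q q' → Q q' p →
    (∀ p' p'', TauCl tau p p' → tau p' p'' → Q q p' ∨ Q q' p'') → Q q p) ∧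
  (∀ q q' p a, step a q q' →
    (∀ p' p'', TauCl tau p p' → step a p' p'' → Q q p' ∨ Q q' p'') → Q q p)

/-- `q` and `p` are branching apart: related by every branching apartness. -/
def BApart {X A : Type*} (tau : X → X → Prop) (step : A → X → X → Prop) (q p : X) : Prop :=
  ∀ Q, IsBranchingApartness tau step Q → Q q p

/-- `Q` is a semi-branching apartness on the LTS `(tau, step)`. -/
def IsSemiBranchingApartness {X A : Type*} (tau : X → X → Prop) (step : A → X → X → Prop)
    (Q : X → X → Prop) : Prop :=
  (∀ q p, Q p q → Q q p) ∧
  (∀ q q' p, tau q q' → Q q' p →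
    (∀ p' p'', TauCl tau p p' → tau p' p'' → Q q' p'' ∨ (Q q p' ∧ Q q p'')) → Q q p) ∧
  (∀ q q' p a, step a q q' →
    (∀ p' p'', TauCl tau p p' → step a p' p'' → Q q p' ∨ Q q' p'') → Q q p)

/-- `q` and `p` are semi-branching apart: related by every semi-branching apartness. -/
def SbApart {X A : Type*} (tau : X → X → Prop) (step : A → X → X → Prop) (q p : X) : Prop :=
  ∀ Q, IsSemiBranchingApartness tau step Q → Q q p

/-- `R` is a semi-branching bisimulation on the LTS `(tau, step)`. -/
def IsSemiBranchingBisimulation {X A : Type*} (tau : X → X → Prop) (step : A → X → X → Prop)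
    (R : X → X → Prop) : Prop :=
  (∀ q p, R p q → R q p) ∧
  (∀ q q' p, tau q q' → R q p → R q' p ∨
    ∃ p' p'', TauCl tau p p' ∧ tau p' p'' ∧ R q' p'' ∧ (R q p' ∨ R q p'')) ∧
  (∀ q q' p a, step a q q' → R q p →
    ∃ p' p'', TauCl tau p p' ∧ step a p' p'' ∧ R q p' ∧ R q' p'')

/-- `StutterClosure tau R q p` holds when `p` lies on a silent path between two states that are
both related to `q`. -/
def StutterClosure {X : Type*} (tau : X → X → Prop) (R : X → X → Prop) (q p : X) : Prop :=
  ∃ p₀ p₁, R q p₀ ∧ R q p₁ ∧ TauCl tau p₀ p ∧ TauCl tau p p₁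

section

variable {X A : Type*} {tau : X → X → Prop} {step : A → X → X → Prop} {R Q : X → X → Prop}

theorem StutterClosure.of_rel {q p : X} (h : R q p) : StutterClosure tau R q p :=
  ⟨p, p, h, h, .refl, .refl⟩

theorem IsSemiBranchingBisimulation.isSemiBranchingApartness_not
    (h : IsSemiBranchingBisimulation tau step R) :
    IsSemiBranchingApartness tau step (fun q p => ¬ R q p) := by
  obtain ⟨hs, ht, ha⟩ := h
  refine ⟨fun q p hn h => hn (hs _ _ h), fun q q' p hq hn hall h => ?_,
    fun q q' p a hq hall h => ?_⟩
  · rcases ht q q' p hq h with h' | ⟨p', p'', h1, h2, h3, h4⟩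
    · exact hn h'
    · have := hall p' p'' h1 h2
      tauto
  · obtain ⟨p', p'', h1, h2, h3, h4⟩ := ha q q' p a hq h
    have := hall p' p'' h1 h2
    tauto

theorem IsSemiBranchingApartness.isSemiBranchingBisimulation_not
    (h : IsSemiBranchingApartness tau step Q) :
    IsSemiBranchingBisimulation tau step (fun q p => ¬ Q q p) := by
  obtain ⟨hs, ht, ha⟩ := h
  refine ⟨fun q p hn h => hn (hs _ _ h), fun q q' p hq hn => ?_, fun q q' p a hq hn => ?_⟩
  · by_contra hc
    push Not at hc
    refine hn (ht q q' p hq hc.1 fun p' p'' h1 h2 => ?_)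
    have := hc.2 p' p'' h1 h2
    tauto
  · by_contra hc
    push Not at hc
    refine hn (ha q q' p a hq fun p' p'' h1 h2 => ?_)
    have := hc p' p'' h1 h2
    tauto

theorem IsBranchingApartness.isSemiBranchingApartness (h : IsBranchingApartness tau step Q) :
    IsSemiBranchingApartness tau step Q := by
  refine ⟨h.1, fun q q' p hq hn hall => h.2.1 q q' p hq hn fun p' p'' h1 h2 => ?_, h.2.2⟩
  have := hall p' p'' h1 h2
  tauto

theorem isSemiBranchingApartness_sbApart :
    IsSemiBranchingApartness tau step (SbApart tau step) := by
  refine ⟨fun q p h Q hQ => hQ.1 _ _ (h Q hQ), fun q q' p hq hn hall Q hQ => ?_,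
    fun q q' p a hq hall Q hQ => ?_⟩
  · exact hQ.2.1 q q' p hq (hn Q hQ) fun p' p'' h1 h2 =>
      (hall p' p'' h1 h2).imp (fun h => h Q hQ) fun h => ⟨h.1 Q hQ, h.2 Q hQ⟩
  · exact hQ.2.2 q q' p a hq fun p' p'' h1 h2 =>
      (hall p' p'' h1 h2).imp (fun h => h Q hQ) fun h => h Q hQ

theorem IsSemiBranchingBisimulation.exists_tauCl (h : IsSemiBranchingBisimulation tau step R)
    {q q' p : X} (hq : TauCl tau q q') (hR : R q p) : ∃ p', TauCl tau p p' ∧ R q' p' := by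
  induction hq with
  | refl => exact ⟨p, .refl, hR⟩
  | tail _ hstep ih =>
    obtain ⟨p', hp, hR'⟩ := ih
    rcases h.2.1 _ _ _ hstep hR' with h' | ⟨r, s, h1, h2, h3, -⟩
    · exact ⟨p', hp, h'⟩
    · exact ⟨s, (Relation.ReflTransGen.trans hp h1).tail h2, h3⟩

/-- If `p` silently reaches a state related to `q`, then `p` can match the silent steps
of `q`. -/
theorem IsSemiBranchingBisimulation.tau_of_tauCl (h : IsSemiBranchingBisimulation tau step R)
    {q q' p p₁ : X} (hq : tau q q') (hp : TauCl tau p p₁) (hR : R q p₁) :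
    R q' p ∨ ∃ p' p'', TauCl tau p p' ∧ tau p' p'' ∧ R q' p'' ∧ (R q p' ∨ R q p'') := by
  rcases h.2.1 _ _ _ hq hR with h' | ⟨r, s, h1, h2, h3⟩
  · rcases Relation.ReflTransGen.cases_tail hp with rfl | ⟨r, h1, h2⟩
    · exact .inl h'
    · exact .inr ⟨r, p₁, h1, h2, h', .inr hR⟩
  · exact .inr ⟨r, s, Relation.ReflTransGen.trans hp h1, h2, h3⟩

theorem IsSemiBranchingBisimulation.exists_tauCl_of_stutterClosure
    (h : IsSemiBranchingBisimulation tau step R) {q p : X}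
    (hqp : StutterClosure tau R q p ∨ StutterClosure tau R p q) :
    ∃ p₁, TauCl tau p p₁ ∧ R q p₁ := by
  rcases hqp with ⟨p₀, p₁, -, h1, -, h2⟩ | ⟨q₀, q₁, h0, -, h1, -⟩
  · exact ⟨p₁, h2, h1⟩
  · exact h.exists_tauCl h1 (h.1 _ _ h0)

theorem IsSemiBranchingBisimulation.stutterClosure
    (h : IsSemiBranchingBisimulation tau step R) :
    IsSemiBranchingBisimulation tau step
      (fun q p => StutterClosure tau R q p ∨ StutterClosure tau R p q) := by
  have lift {x y : X} (hR : R x y) : StutterClosure tau R x y ∨ StutterClosure tau R y x :=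
    .inl (.of_rel hR)
  refine ⟨fun q p => Or.symm, fun q q' p hq hqp => ?_, fun q q' p a hq hqp => ?_⟩
  · obtain ⟨p₁, hp, hR⟩ := h.exists_tauCl_of_stutterClosure hqp
    exact (h.tau_of_tauCl hq hp hR).imp lift fun ⟨r, s, h1, h2, h3, h4⟩ =>
      ⟨r, s, h1, h2, lift h3, h4.imp lift lift⟩
  · obtain ⟨p₁, hp, hR⟩ := h.exists_tauCl_of_stutterClosure hqp
    obtain ⟨r, s, h1, h2, h3, h4⟩ := h.2.2 _ _ _ _ hq hR
    exact ⟨r, s, Relation.ReflTransGen.trans hp h1, h2, lift h3, lift h4⟩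

/-- Semi-branching apartness satisfies the stuttering property. -/
theorem not_sbApart_of_stutterClosure {q p : X}
    (hqp : StutterClosure tau (fun q p => ¬ SbApart tau step q p) q p) :
    ¬ SbApart tau step q p := fun hn =>
  have h := isSemiBranchingApartness_sbApart.isSemiBranchingBisimulation_not.stutterClosure
  hn _ h.isSemiBranchingApartness_not (.inl hqp)

theorem isBranchingApartness_sbApart : IsBranchingApartness tau step (SbApart tau step) := by
  have hsb := isSemiBranchingApartness_sbApart (tau := tau) (step := step)
  refine ⟨hsb.1, fun q q' p hq hn hall => ?_, hsb.2.2⟩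
  by_contra hqp
  refine hqp (hsb.2.1 q q' p hq hn fun p' p'' h1 h2 => ?_)
  by_contra! hc
  obtain ⟨hc1, hc2⟩ := hc
  have hp' : SbApart tau step q p' := (hall p' p'' h1 h2).resolve_right hc1
  exact not_sbApart_of_stutterClosure ⟨p, p'', hqp, hc2 hp', h1, .single h2⟩ hp'

end

theorem bApart_iff_sbApart {X A : Type*} (tau : X → X → Prop) (step : A → X → X → Prop)
    (q p : X) : BApart tau step q p ↔ SbApart tau step q p := by
  exact ⟨fun h => h _ isBranchingApartness_sbApart,
    fun h Q hQ => h Q hQ.isSemiBranchingApartness⟩
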